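/- Let D ⊆ 2^[4] be a down set with ∅ ∈ D and nonempty complement U = 2^[4] \ D. Then sdepth(U) > sdepth(D). (This is the combinatorial statement, via Herzog–Vladoiu–Zheng, of: if I is a squarefree monomial ideal of S = K[x₁,x₂,x₃,x₄], then sdepth I > sdepth S/I.) -/

import Mathlib

open Finset

/-- An interval partition of a family `Q` of subsets of `[n]` (identified with `Fin n`):
a finite collection of nonempty intervals `[A,B]`, each contained in `Q`, pairwise
disjoint, and covering `Q`. -/
structure IntervalPartition (n : ℕ) (Q : Finset (Finset (Fin n))) where
  pairs : Finset (Finset (Fin n) × Finset (Fin n))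
  le : ∀ p ∈ pairs, p.1 ⊆ p.2
  sub : ∀ p ∈ pairs, Finset.Icc p.1 p.2 ⊆ Q
  disj : ∀ p ∈ pairs, ∀ q ∈ pairs, p ≠ q →
    Disjoint (Finset.Icc p.1 p.2) (Finset.Icc q.1 q.2)
  covers : ∀ C ∈ Q, ∃ p ∈ pairs, C ∈ Finset.Icc p.1 p.2

/-- The Stanley depth of a family `Q`: the largest `k` such that some interval
partition of `Q` has every interval's maximal element of size at least `k`. -/
noncomputable def sdepth {n : ℕ} (Q : Finset (Finset (Fin n))) : ℕ :=
  sSup {k | ∃ P : IntervalPartition n Q, ∀ p ∈ P.pairs, k ≤ p.2.card}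

/-- `D` is a down set in `2^[n]`. -/
def IsDownSet {n : ℕ} (D : Finset (Finset (Fin n))) : Prop :=
  ∀ B ∈ D, ∀ A, A ⊆ B → A ∈ D

/-- `B` is a maximal element of the family `D`. -/
def MaxElt {n : ℕ} (D : Finset (Finset (Fin n))) (B : Finset (Fin n)) : Prop :=
  B ∈ D ∧ ∀ C ∈ D, B ⊆ C → B = C

section Bounds

variable {n : ℕ}

theorem bddAbove_sdepth_set {Q : Finset (Finset (Fin n))} (hQ : Q.Nonempty) :
    BddAbove {k | ∃ P : IntervalPartition n Q, ∀ p ∈ P.pairs, k ≤ p.2.card} := by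
  refine ⟨n, ?_⟩
  rintro k ⟨P, hP⟩
  obtain ⟨C, hC⟩ := hQ
  obtain ⟨p, hp, -⟩ := P.covers C hC
  exact (hP p hp).trans (card_finset_fin_le _)

/-- A family of pairwise disjoint intervals in `Q` with large tops, which covers all small
members of `Q`, extends by singletons to an interval partition. -/
theorem le_sdepth_of_partial {Q : Finset (Finset (Fin n))} (hQ : Q.Nonempty) (k : ℕ)
    (L : Finset (Finset (Fin n) × Finset (Fin n)))
    (hle : ∀ p ∈ L, p.1 ⊆ p.2) (hsub : ∀ p ∈ L, Icc p.1 p.2 ⊆ Q)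
    (hdisj : ∀ p ∈ L, ∀ q ∈ L, ∀ C, C ∈ Icc p.1 p.2 → C ∈ Icc q.1 q.2 → p = q)
    (hcard : ∀ p ∈ L, k ≤ p.2.card)
    (hcov : ∀ C ∈ Q, C.card < k → ∃ p ∈ L, C ∈ Icc p.1 p.2) :
    k ≤ sdepth Q := by
  classical
  refine le_csSup (bddAbove_sdepth_set hQ) ?_
  let R := {C ∈ Q | ∀ p ∈ L, C ∉ Icc p.1 p.2}
  have hR : ∀ p, p ∈ L ∪ R.image (fun C => (C, C)) ↔
      p ∈ L ∨ ∃ C ∈ Q, (∀ p ∈ L, C ∉ Icc p.1 p.2) ∧ (C, C) = p := by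
    intro p
    simp [R, and_assoc]
  refine ⟨⟨L ∪ R.image (fun C => (C, C)), ?_, ?_, ?_, ?_⟩, ?_⟩
  · intro p hp
    rcases (hR p).1 hp with h | ⟨C, -, -, rfl⟩
    · exact hle p h
    · exact subset_rfl
  · intro p hp
    rcases (hR p).1 hp with h | ⟨C, hC, -, rfl⟩
    · exact hsub p h
    · simpa using hC
  · intro p hp q hq hpq
    rw [Finset.disjoint_left]
    intro C hCp hCq
    rcases (hR p).1 hp with h | ⟨A, -, hA, rfl⟩ <;> rcases (hR q).1 hq with h' | ⟨B, -, hB, rfl⟩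
    · exact hpq (hdisj p h q h' C hCp hCq)
    · rw [Icc_self, mem_singleton] at hCq
      subst hCq
      exact hB p h hCp
    · rw [Icc_self, mem_singleton] at hCp
      subst hCp
      exact hA q h' hCq
    · rw [Icc_self, mem_singleton] at hCp hCq
      exact hpq (congrArg (fun C => (C, C)) (hCp.symm.trans hCq))
  · intro C hC
    by_cases h : ∃ p ∈ L, C ∈ Icc p.1 p.2
    · obtain ⟨p, hp, hCp⟩ := h
      exact ⟨p, (hR p).2 (Or.inl hp), hCp⟩
    · push Not at h
      exact ⟨(C, C), (hR _).2 (Or.inr ⟨C, hC, h, rfl⟩), by simp⟩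
  · intro p hp
    rcases (hR p).1 hp with h | ⟨C, hC, h, rfl⟩
    · exact hcard p h
    · by_contra! hlt
      obtain ⟨p, hp, hCp⟩ := hcov C hC hlt
      exact h p hp hCp

theorem exists_partition_sdepth {Q : Finset (Finset (Fin n))} (hQ : Q.Nonempty) :
    ∃ P : IntervalPartition n Q, ∀ p ∈ P.pairs, sdepth Q ≤ p.2.card := by
  refine Nat.sSup_mem (s := {k | ∃ P : IntervalPartition n Q, ∀ p ∈ P.pairs, k ≤ p.2.card})
    ⟨0, ⟨Q.image (fun C => (C, C)), ?_, ?_, ?_, ?_⟩, ?_⟩ (bddAbove_sdepth_set hQ)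
  · simp
  · simp
  · simp only [mem_image]
    rintro _ ⟨A, -, rfl⟩ _ ⟨B, -, rfl⟩ h
    have hAB : A ≠ B := fun e => h (by rw [e])
    simpa using hAB
  · intro C hC
    exact ⟨(C, C), mem_image_of_mem _ hC, by simp⟩
  · simp

/-- If the smallest members of an up set can be matched injectively into the next level, then
its Stanley depth exceeds their size. -/
theorem succ_le_sdepth_of_matching {Q : Finset (Finset (Fin n))} (hQ : Q.Nonempty) (m : ℕ)
    (hup : ∀ A ∈ Q, ∀ B, A ⊆ B → B ∈ Q) (hm : ∀ C ∈ Q, m ≤ C.card)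
    (f : Finset (Fin n) → Finset (Fin n))
    (hf : ∀ C ∈ Q, C.card = m → C ⊆ f C ∧ (f C).card = m + 1)
    (hinj : ∀ A ∈ Q, ∀ B ∈ Q, A.card = m → B.card = m → f A = f B → A = B) :
    m + 1 ≤ sdepth Q := by
  classical
  have hL : ∀ p, p ∈ {C ∈ Q | C.card = m}.image (fun C => (C, f C)) ↔
      ∃ C, (C ∈ Q ∧ C.card = m) ∧ (C, f C) = p := by
    simp
  refine le_sdepth_of_partial hQ (m + 1) ({C ∈ Q | C.card = m}.image (fun C => (C, f C)))
    ?_ ?_ ?_ ?_ ?_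
  · intro p hp
    obtain ⟨C, ⟨hC, hCm⟩, rfl⟩ := (hL p).1 hp
    exact (hf C hC hCm).1
  · intro p hp B hB
    obtain ⟨C, ⟨hC, hCm⟩, rfl⟩ := (hL p).1 hp
    exact hup C hC B (mem_Icc.1 hB).1
  · intro p hp q hq C hCp hCq
    obtain ⟨A, ⟨hA, hAm⟩, rfl⟩ := (hL p).1 hp
    obtain ⟨B, ⟨hB, hBm⟩, rfl⟩ := (hL q).1 hq
    obtain ⟨hAC, hCA⟩ := mem_Icc.1 hCp
    obtain ⟨hBC, hCB⟩ := mem_Icc.1 hCq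
    dsimp only at hAC hCA hBC hCB
    have hfA := (hf A hA hAm).2
    have hfB := (hf B hB hBm).2
    have hAB : A = B := by
      rcases Nat.lt_or_ge m C.card with h | h
      · refine hinj A hA B hB hAm hBm ?_
        rw [← eq_of_subset_of_card_le hCA (by omega), ← eq_of_subset_of_card_le hCB (by omega)]
      · rw [eq_of_subset_of_card_le hAC (by omega), eq_of_subset_of_card_le hBC (by omega)]
    rw [hAB]
  · intro p hp
    obtain ⟨C, ⟨hC, hCm⟩, rfl⟩ := (hL p).1 hp
    exact (hf C hC hCm).2.ge
  · intro C hC hlt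
    have hCm : C.card = m := by
      have := hm C hC
      omega
    exact ⟨(C, f C), (hL _).2 ⟨C, ⟨hC, hCm⟩, rfl⟩, mem_Icc.2 ⟨subset_rfl, (hf C hC hCm).1⟩⟩

/-- A proper simplicial complex on `X` whose faces all extend to faces with at least `|X| - 1`
vertices has an interval as its complement. -/
theorem IsDownSet.exists_notMem_iff_subset {D : Finset (Finset (Fin n))} (hD : IsDownSet D)
    {X : Finset (Fin n)} (hX : X ∉ D)
    (h : ∀ C ∈ D, C ⊆ X → ∃ B ∈ D, C ⊆ B ∧ B ⊆ X ∧ X.card ≤ B.card + 1) :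
    ∃ T ⊆ X, ∀ C ⊆ X, C ∉ D ↔ T ⊆ C := by
  classical
  refine ⟨{i ∈ X | X.erase i ∈ D}, filter_subset _ _, fun C hC => ⟨fun hCD i hi => ?_, ?_⟩⟩
  · by_contra hiC
    exact hCD (hD _ (mem_filter.1 hi).2 C (subset_erase.2 ⟨hC, hiC⟩))
  · intro hT hCD
    obtain ⟨B, hB, hCB, hBX, hcard⟩ := h C hCD hC
    have hne : B ≠ X := fun e => hX (e ▸ hB)
    obtain ⟨i, hiX, hiB⟩ := exists_of_ssubset (hBX.ssubset_of_ne hne)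
    have hBe : B = X.erase i := by
      refine eq_of_subset_of_card_le (subset_erase.2 ⟨hBX, hiB⟩) ?_
      rw [card_erase_of_mem hiX]
      omega
    exact hiB (hCB (hT (mem_filter.2 ⟨hiX, hBe ▸ hB⟩)))

theorem IntervalPartition.exists_superset {Q : Finset (Finset (Fin n))}
    (P : IntervalPartition n Q) {k : ℕ} (hP : ∀ p ∈ P.pairs, k ≤ p.2.card) :
    ∀ C ∈ Q, ∃ B ∈ Q, C ⊆ B ∧ k ≤ B.card := by
  intro C hC
  obtain ⟨p, hp, hCp⟩ := P.covers C hC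
  exact ⟨p.2, P.sub p hp (mem_Icc.2 ⟨P.le p hp, subset_rfl⟩), (mem_Icc.1 hCp).2, hP p hp⟩

/-- A simplicial complex of Stanley depth at least two has at least as many edges as a spanning
tree on its vertex set. -/
theorem IntervalPartition.le_card_pairs {D : Finset (Finset (Fin n))}
    (P : IntervalPartition n D) (hP : ∀ p ∈ P.pairs, 2 ≤ p.2.card) (h0 : ∅ ∈ D)
    (hv : ∀ i, {i} ∈ D) : n ≤ #{e ∈ D | e.card = 2} + 1 := by
  classical
  choose F hF hmem using fun i => P.covers {i} (hv i)
  obtain ⟨p₀, hp₀, h₀⟩ := P.covers ∅ h0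
  have huniq : ∀ p ∈ P.pairs, ∀ q ∈ P.pairs, ∀ C, C ∈ Icc p.1 p.2 → C ∈ Icc q.1 q.2 → p = q := by
    intro p hp q hq C hCp hCq
    by_contra hne
    exact Finset.disjoint_left.1 (P.disj p hp q hq hne) hCp hCq
  have hp₀1 : p₀.1 = ∅ := subset_empty.1 (mem_Icc.1 h₀).1
  obtain ⟨b, hb⟩ : p₀.2.Nonempty := card_pos.1 (by have := hP p₀ hp₀; omega)
  have hiF : ∀ i, i ∈ (F i).2 := fun i => singleton_subset_iff.1 (mem_Icc.1 (hmem i)).2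
  have key : ∀ i, i ≠ b → ∃ j, j ≠ i ∧ j ∈ (F i).2 ∧ (F i = p₀ → j = b) := by
    intro i hi
    by_cases h : F i = p₀
    · exact ⟨b, hi.symm, h ▸ hb, fun _ => rfl⟩
    · obtain ⟨j, hj, hji⟩ := exists_mem_ne (hP _ (hF i)) i
      exact ⟨j, hji, hj, fun h' => absurd h' h⟩
  choose! g hgne hgF hgb using key
  have hedge : ∀ i, i ≠ b → ({i, g i} : Finset (Fin n)) ∈ Icc (F i).1 (F i).2 := by
    intro i hi
    refine mem_Icc.2 ⟨(mem_Icc.1 (hmem i)).1.trans (by simp), ?_⟩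
    exact insert_subset (hiF i) (singleton_subset_iff.2 (hgF i hi))
  have hle : #(univ.erase b) ≤ #{e ∈ D | e.card = 2} := by
    refine card_le_card_of_injOn (fun i => {i, g i}) ?_ ?_
    · intro i hi
      have hi' : i ≠ b := by simpa using hi
      exact mem_filter.2 ⟨P.sub _ (hF i) (hedge i hi'), card_pair (hgne i hi').symm⟩
    · intro i hi j hj hij
      have hi' : i ≠ b := by simpa using hi
      have hj' : j ≠ b := by simpa using hj
      replace hij : ({i, g i} : Finset (Fin n)) = {j, g j} := hij
      have hFij : F i = F j := huniq _ (hF i) _ (hF j) _ (hedge i hi') (hij ▸ hedge j hj')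
      by_contra hne
      have h1 : (F i).1 = ∅ := by
        refine subset_empty.1 fun x hx => ?_
        have hxi := mem_singleton.1 ((mem_Icc.1 (hmem i)).1 hx)
        have hxj := mem_singleton.1 ((mem_Icc.1 (hmem j)).1 (hFij ▸ hx))
        exact absurd (hxi.symm.trans hxj) hne
      have hFp : F i = p₀ := huniq _ (hF i) _ hp₀ ∅ (by simp [h1]) h₀
      have hgi := hgb i hi' hFp
      have hgj := hgb j hj' (hFij ▸ hFp)
      have : i ∈ ({j, g j} : Finset (Fin n)) := hij ▸ mem_insert_self _ _
      rw [hgj, mem_insert, mem_singleton] at this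
      exact this.elim hne hi'
  rw [card_erase_of_mem (mem_univ b), card_univ, Fintype.card_fin] at hle
  omega

end Bounds

/-- Three or fewer edges of a tetrahedron can be matched with distinct facets containing them. -/
theorem exists_matching_pairs_triples (N : Finset (Finset (Fin 4))) (hN : ∀ e ∈ N, e.card = 2)
    (hcard : N.card ≤ 3) :
    ∃ f : Finset (Fin 4) → Finset (Fin 4), (∀ e ∈ N, e ⊆ f e ∧ (f e).card = 3) ∧
      ∀ a ∈ N, ∀ b ∈ N, f a = f b → a = b := by
  let t : Finset (Fin 4) → Finset (Finset (Fin 4)) := fun e => eᶜ.image (insert · e)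
  have ht1 : ∀ a : Finset (Fin 4), a.card = 2 → 1 ≤ (aᶜ.image (insert · a)).card := by
    decide +kernel
  have ht2 : ∀ a b : Finset (Fin 4), a.card = 2 → b.card = 2 → a ≠ b →
      3 ≤ (aᶜ.image (insert · a) ∪ bᶜ.image (insert · b)).card := by
    decide +kernel
  have ht : ∀ e : Finset (Fin 4), e.card = 2 → ∀ T ∈ eᶜ.image (insert · e),
      e ⊆ T ∧ T.card = 3 := by
    decide +kernel
  obtain ⟨f, hinj, hf⟩ := (Finset.all_card_le_biUnion_card_iff_exists_injective
    (fun e : N => t e.1)).1 (by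
      intro s
      have hs : s.card ≤ 3 := (card_le_univ s).trans (by simpa using hcard)
      rcases s.eq_empty_or_nonempty with rfl | ⟨a, ha⟩
      · simp
      by_cases h : ∃ b ∈ s, a ≠ b
      · obtain ⟨b, hb, hab⟩ := h
        refine hs.trans ((ht2 a b (hN a a.2) (hN b b.2) (Subtype.coe_ne_coe.2 hab)).trans ?_)
        exact card_le_card (union_subset (subset_biUnion_of_mem (fun e : N => t e.1) ha)
          (subset_biUnion_of_mem (fun e : N => t e.1) hb))
      · push Not at h
        refine (card_le_one.2 fun x hx y hy => (h x hx).symm.trans (h y hy)).trans ?_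
        exact (ht1 a (hN a a.2)).trans
          (card_le_card (subset_biUnion_of_mem (fun e : N => t e.1) ha)))
  refine ⟨fun e => if h : e ∈ N then f ⟨e, h⟩ else ∅, ?_, ?_⟩
  · intro e he
    simp only [he, dite_true]
    exact ht e (hN e he) _ (hf ⟨e, he⟩)
  · intro a ha b hb hab
    simp only [ha, hb, dite_true] at hab
    exact congrArg Subtype.val (hinj hab)

/-- If `D ⊆ 2^[4]` is a down set with `∅ ∈ D` and nonempty complement
`U = 2^[4] \ D`, then `sdepth(U) > sdepth(D)`. -/
theorem sdepth_ideal_gt_quotient_four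
    (D : Finset (Finset (Fin 4))) (hD : IsDownSet D) (h0 : ∅ ∈ D)
    (hU : ((Finset.univ : Finset (Finset (Fin 4))) \ D).Nonempty) :
    sdepth D < sdepth ((Finset.univ : Finset (Finset (Fin 4))) \ D) := by
  classical
  set U := (univ : Finset (Finset (Fin 4))) \ D with hUdef
  have hmemU : ∀ C, C ∈ U ↔ C ∉ D := by simp [hUdef]
  have hup : ∀ A ∈ U, ∀ B, A ⊆ B → B ∈ U := fun A hA B hAB =>
    (hmemU B).2 fun hB => (hmemU A).1 hA (hD B hB A hAB)
  have huniv : univ ∉ D := by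
    obtain ⟨C, hC⟩ := hU
    exact (hmemU _).1 (hup C hC univ (subset_univ C))
  obtain ⟨P, hP⟩ := exists_partition_sdepth ⟨∅, h0⟩
  have hsup := P.exists_superset hP
  have hk : sdepth D ≤ 3 := by
    obtain ⟨B, hB, -, hkB⟩ := hsup ∅ h0
    by_contra! hlt
    refine huniv ((eq_of_subset_of_card_le (subset_univ B) ?_) ▸ hB)
    rw [card_univ, Fintype.card_fin]
    omega
  rcases Nat.lt_or_ge (sdepth D) 2 with hk2 | hk2
  · suffices 1 + 1 ≤ sdepth U by omega
    have hshift : ∀ C : Finset (Fin 4), C.card = 1 →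
        C ⊆ C ∪ C.image (· + 1) ∧ (C ∪ C.image (· + 1)).card = 1 + 1 := by decide +kernel
    have hinj : ∀ A B : Finset (Fin 4), A.card = 1 → B.card = 1 →
        A ∪ A.image (· + 1) = B ∪ B.image (· + 1) → A = B := by decide +kernel
    refine succ_le_sdepth_of_matching hU 1 hup (fun C hC => ?_) (fun C => C ∪ C.image (· + 1))
      (fun C _ => hshift C) fun A _ B _ => hinj A B
    refine card_pos.2 (nonempty_iff_ne_empty.2 ?_)
    rintro rfl
    exact (hmemU _).1 hC h0
  rcases Nat.lt_or_ge (sdepth D) 3 with hk3 | hk3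
  · suffices 3 ≤ sdepth U by omega
    by_cases hv : ∀ i, {i} ∈ D
    · have hsmall : ∀ C ∈ U, 2 ≤ C.card := by
        intro C hC
        by_contra! hlt
        refine (hmemU C).1 hC ?_
        rcases C.eq_empty_or_nonempty with rfl | hne
        · exact h0
        · obtain ⟨i, rfl⟩ := card_eq_one.1 (by have := hne.card_pos; omega : C.card = 1)
          exact hv i
      have hE := P.le_card_pairs (fun p hp => hk2.trans (hP p hp)) h0 hv
      have hN : #{e ∈ U | e.card = 2} ≤ 3 := by
        have hdisj : Disjoint {e ∈ U | e.card = 2} {e ∈ D | e.card = 2} :=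
          disjoint_filter_filter sdiff_disjoint
        have hle : #({e ∈ U | e.card = 2} ∪ {e ∈ D | e.card = 2}) ≤
            #(powersetCard 2 (univ : Finset (Fin 4))) := by
          refine card_le_card fun e he => mem_powersetCard.2 ⟨subset_univ _, ?_⟩
          rcases mem_union.1 he with h | h <;> exact (mem_filter.1 h).2
        have h6 : Nat.choose 4 2 = 6 := rfl
        rw [card_union_of_disjoint hdisj, card_powersetCard, card_univ, Fintype.card_fin, h6] at hle
        omega
      obtain ⟨f, hf, hinj⟩ := exists_matching_pairs_triples _ (fun e he => (mem_filter.1 he).2) hN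
      exact succ_le_sdepth_of_matching hU 2 hup hsmall f
        (fun C hC h2 => hf C (mem_filter.2 ⟨hC, h2⟩)) fun A hA B hB hA2 hB2 =>
          hinj A (mem_filter.2 ⟨hA, hA2⟩) B (mem_filter.2 ⟨hB, hB2⟩)
    · push Not at hv
      obtain ⟨w, hw⟩ := hv
      have hwD : ∀ C, w ∈ C → C ∉ D := fun C hwC hC =>
        hw (hD C hC _ (singleton_subset_iff.2 hwC))
      have hX3 : #((univ : Finset (Fin 4)).erase w) = 3 := by simp
      have hsubX : ∀ C : Finset (Fin 4), w ∉ C → C ⊆ univ.erase w := fun C hC =>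
        subset_erase.2 ⟨subset_univ _, hC⟩
      by_cases hX : univ.erase w ∈ D
      · refine le_sdepth_of_partial hU 3 {({w}, univ)} ?_ ?_ ?_ ?_ ?_
        · simp
        · simp only [mem_singleton, forall_eq]
          intro C hC
          exact (hmemU C).2 (hwD C (singleton_subset_iff.1 (mem_Icc.1 hC).1))
        · simp
        · simp
        · intro C hC _
          refine ⟨_, mem_singleton_self _, mem_Icc.2 ⟨singleton_subset_iff.2 ?_, subset_univ C⟩⟩
          by_contra hwC
          exact (hmemU C).1 hC (hD _ hX C (hsubX C hwC))
      · obtain ⟨T, hTX, hT⟩ := hD.exists_notMem_iff_subset hX (by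
          intro C hC _
          obtain ⟨B, hB, hCB, hkB⟩ := hsup C hC
          exact ⟨B, hB, hCB, hsubX B fun hwB => hwD B hwB hB, by omega⟩)
        have hdis : ∀ C, C ∈ Icc {w} univ → C ∉ Icc T (univ.erase w) := fun C h1 h2 =>
          notMem_erase w univ ((mem_Icc.1 h2).2 (singleton_subset_iff.1 (mem_Icc.1 h1).1))
        refine le_sdepth_of_partial hU 3 {({w}, univ), (T, univ.erase w)} ?_ ?_ ?_ ?_ ?_
        · simpa using hTX
        · simp only [mem_insert, mem_singleton, forall_eq_or_imp, forall_eq]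
          refine ⟨fun C hC => ?_, fun C hC => ?_⟩
          · exact (hmemU C).2 (hwD C (singleton_subset_iff.1 (mem_Icc.1 hC).1))
          · exact (hmemU C).2 ((hT C (mem_Icc.1 hC).2).2 (mem_Icc.1 hC).1)
        · simp only [mem_insert, mem_singleton]
          rintro p (rfl | rfl) q (rfl | rfl) C h1 h2
          · rfl
          · exact absurd h2 (hdis C h1)
          · exact absurd h1 (hdis C h2)
          · rfl
        · simp
        · intro C hC _
          by_cases hwC : w ∈ C
          · exact ⟨({w}, univ), by simp, mem_Icc.2 ⟨singleton_subset_iff.2 hwC, subset_univ C⟩⟩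
          · exact ⟨(T, univ.erase w), by simp,
              mem_Icc.2 ⟨(hT C (hsubX C hwC)).1 ((hmemU C).1 hC), hsubX C hwC⟩⟩
  · suffices 4 ≤ sdepth U by omega
    obtain ⟨T, -, hT⟩ := hD.exists_notMem_iff_subset huniv (by
      intro C hC _
      obtain ⟨B, hB, hCB, hkB⟩ := hsup C hC
      refine ⟨B, hB, hCB, subset_univ B, ?_⟩
      rw [card_univ, Fintype.card_fin]
      omega)
    refine le_sdepth_of_partial hU 4 {(T, univ)} ?_ ?_ ?_ ?_ ?_
    · simp
    · simp only [mem_singleton, forall_eq]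
      intro C hC
      exact (hmemU C).2 ((hT C (subset_univ C)).2 (mem_Icc.1 hC).1)
    · simp
    · simp
    · intro C hC _
      exact ⟨_, mem_singleton_self _,
        mem_Icc.2 ⟨(hT C (subset_univ C)).1 ((hmemU C).1 hC), subset_univ C⟩⟩
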